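/- Let h : [0,1] → ℝ be an increasing convex function whose left derivative h′₋ satisfies ‖h′₋‖_q < ∞, and define the distortion functional ρ_h(Z) = ∫₀¹ F_Z^{−1}(s) h′₋(s) ds for random variables Z with finite p-th moment. Then for every p ∈ [1,∞] with Hölder conjugate q, every Borel probability distribution F₀ on ℝⁿ with finite p-th moment, every ε ≥ 0, and every D ⊆ ℝ^{n−1}: inf_{β_r∈D} sup_{F∈B_p(F₀,ε)} ρ_h^F(|(1,−β_r)^⊤X|) = inf_{β_r∈D} { ρ_h^{F₀}(|(1,−β_r)^⊤X|) + ‖h′₋‖_q · ε‖(1,−β_r)‖_* }, where ‖g‖_q = (∫₀¹ |g(s)|^q ds)^{1/q} (essential supremum over (0,1) for q = ∞). -/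

import Mathlib

open MeasureTheory Set
open scoped ENNReal NNReal

noncomputable section

abbrev Vec (n : ℕ) := Fin n → ℝ

/-- `β^⊤x` -/
def dotp {n : ℕ} (β x : Vec n) : ℝ := ∑ i, β i * x i

/-- `nrm` is a norm on `ℝⁿ`. -/
def IsNorm {n : ℕ} (nrm : Vec n → ℝ) : Prop :=
  (∀ x, nrm x = 0 ↔ x = 0) ∧
  (∀ (c : ℝ) (x : Vec n), nrm (c • x) = |c| * nrm x) ∧
  (∀ x y : Vec n, nrm (x + y) ≤ nrm x + nrm y)

/-- the dual norm `‖β‖_* = sup_{‖x‖ ≤ 1} β^⊤x`. -/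
def dualNorm {n : ℕ} (nrm : Vec n → ℝ) (β : Vec n) : ℝ :=
  sSup {r | ∃ x, nrm x ≤ 1 ∧ r = dotp β x}

/-- Couplings of two probability measures. -/
def Couplings {E : Type*} [MeasurableSpace E] (μ ν : Measure E) : Set (Measure (E × E)) :=
  {π | IsProbabilityMeasure π ∧ π.map Prod.fst = μ ∧ π.map Prod.snd = ν}

/-- The type-`p` Wasserstein distance (valued in `ℝ≥0∞`) associated with an
extended-real-valued cost; for `p = ∞` it is the infimum over couplings of the essential
supremum of the cost. -/
def WassersteinD {E : Type*} [MeasurableSpace E] (cost : E → E → ℝ≥0∞) (p : ℝ≥0∞)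
    (μ ν : Measure E) : ℝ≥0∞ :=
  if p = ∞ then ⨅ π ∈ Couplings μ ν, essSup (fun z : E × E => cost z.1 z.2) π
  else ⨅ π ∈ Couplings μ ν, (∫⁻ z, cost z.1 z.2 ^ p.toReal ∂π) ^ (1 / p.toReal)

/-- Finite `p`-th moment (with respect to a "norm-like" function `nrm`);
for `p = ∞` it means essential boundedness. -/
def HasMomentP {E : Type*} [MeasurableSpace E] (nrm : E → ℝ) (p : ℝ≥0∞) (μ : Measure E) : Prop :=
  if p = ∞ then essSup (fun x => ENNReal.ofReal (nrm x)) μ ≠ ∞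
  else ∫⁻ x, ENNReal.ofReal (nrm x) ^ p.toReal ∂μ ≠ ∞

/-- The type-`p` Wasserstein ball of probability distributions on `ℝⁿ` (norm `nrm`). -/
def WballVec {n : ℕ} (nrm : Vec n → ℝ) (p : ℝ≥0∞) (μ₀ : Measure (Vec n)) (ε : ℝ) :
    Set (Measure (Vec n)) :=
  {μ | IsProbabilityMeasure μ ∧ HasMomentP nrm p μ ∧
    WassersteinD (fun x y => ENNReal.ofReal (nrm (x - y))) p μ μ₀ ≤ ENNReal.ofReal ε}

/-- The type-`p` Wasserstein ball of probability distributions on `ℝ`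
(absolute-value norm). -/
def WballReal (p : ℝ≥0∞) (μ₀ : Measure ℝ) (ε : ℝ) : Set (Measure ℝ) :=
  {μ | IsProbabilityMeasure μ ∧ HasMomentP (fun x : ℝ => |x|) p μ ∧
    WassersteinD (fun x y : ℝ => ENNReal.ofReal |x - y|) p μ μ₀ ≤ ENNReal.ofReal ε}

/-- The metric on `Ξ = {-1,1} × ℝⁿ`:
`d((y₁,x₁),(y₂,x₂)) = ‖x₁ - x₂‖` if `y₁ = y₂`, and `+∞` otherwise. -/
def xiCost {n : ℕ} (nrm : Vec n → ℝ) (z₁ z₂ : ℝ × Vec n) : ℝ≥0∞ :=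
  if z₁.1 = z₂.1 then ENNReal.ofReal (nrm (z₁.2 - z₂.2)) else ∞

/-- A measure on `ℝ × ℝⁿ` is concentrated on `Ξ = {-1,1} × ℝⁿ`. -/
def OnXi {n : ℕ} (μ : Measure (ℝ × Vec n)) : Prop :=
  μ {z | z.1 = 1 ∨ z.1 = -1} = 1

/-- The type-`p` Wasserstein ball `B̄_p(F₀,ε)` of probability distributions on
`Ξ = {-1,1} × ℝⁿ`. -/
def WballXi {n : ℕ} (nrm : Vec n → ℝ) (p : ℝ≥0∞) (μ₀ : Measure (ℝ × Vec n)) (ε : ℝ) :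
    Set (Measure (ℝ × Vec n)) :=
  {μ | IsProbabilityMeasure μ ∧ OnXi μ ∧ HasMomentP (fun z => nrm z.2) p μ ∧
    WassersteinD (xiCost nrm) p μ μ₀ ≤ ENNReal.ofReal ε}

/-- The left-quantile function `F⁻¹(s) = inf {x : P(Z ≤ x) ≥ s}` of a distribution on `ℝ`. -/
def leftQuantile (μ : Measure ℝ) (s : ℝ) : ℝ :=
  sInf {x : ℝ | ENNReal.ofReal s ≤ μ (Set.Iic x)}

/-- The left derivative `h′₋`. -/
def leftDeriv (h : ℝ → ℝ) (s : ℝ) : ℝ := derivWithin h (Set.Iio s) s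

/-- The distortion functional `ρ_h(F) = ∫₀¹ F⁻¹(s) h′₋(s) ds`. -/
def distortion (h : ℝ → ℝ) (μ : Measure ℝ) : ℝ :=
  ∫ s in (0 : ℝ)..1, leftQuantile μ s * leftDeriv h s

/-- The `L^q` norm `‖g‖_q = (∫₀¹ |g|^q ds)^{1/q}` on `(0,1)` (essential supremum for
`q = ∞`), valued in `ℝ≥0∞`. -/
def LqNorm01 (g : ℝ → ℝ) (q : ℝ≥0∞) : ℝ≥0∞ :=
  eLpNorm g q (volume.restrict (Set.Ioo (0 : ℝ) 1))

/-- The uniform distribution on `(0,1)`. -/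
def unif01 : Measure ℝ := volume.restrict (Set.Ioo (0 : ℝ) 1)

instance : IsProbabilityMeasure unif01 := ⟨by simp [unif01]⟩

lemma ae_unif01_mem : ∀ᵐ s ∂unif01, s ∈ Set.Ioo (0 : ℝ) 1 :=
  ae_restrict_mem measurableSet_Ioo

section Quantile

variable (μ : Measure ℝ) [IsProbabilityMeasure μ]

lemma leftQuantile_le_iff {s : ℝ} (hs : s ∈ Set.Ioo (0 : ℝ) 1) (x : ℝ) :
    leftQuantile μ s ≤ x ↔ s ≤ ProbabilityTheory.cdf μ x := by
  have hset : {x : ℝ | ENNReal.ofReal s ≤ μ (Set.Iic x)}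
      = {x | s ≤ ProbabilityTheory.cdf μ x} := by
    ext x
    simp only [mem_ofPred_eq, ← ProbabilityTheory.ofReal_cdf]
    exact ENNReal.ofReal_le_ofReal_iff (ProbabilityTheory.cdf_nonneg μ x)
  have hbdd : BddBelow {x | s ≤ ProbabilityTheory.cdf μ x} := by
    obtain ⟨a, ha⟩ := ((ProbabilityTheory.tendsto_cdf_atBot μ).eventually
      (gt_mem_nhds hs.1)).exists
    refine ⟨a, fun y hy => ?_⟩
    by_contra! hya
    exact absurd (hy.trans (ProbabilityTheory.monotone_cdf μ hya.le)) (not_le.2 ha)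
  have hne : {x | s ≤ ProbabilityTheory.cdf μ x}.Nonempty := by
    obtain ⟨a, ha⟩ := ((ProbabilityTheory.tendsto_cdf_atTop μ).eventually
      (lt_mem_nhds hs.2)).exists
    exact ⟨a, le_of_lt ha⟩
  rw [leftQuantile, hset]
  refine ⟨fun hx => ?_, fun hx => csInf_le hbdd hx⟩
  have hcont : ContinuousWithinAt (ProbabilityTheory.cdf μ) (Set.Ioi x) x :=
    ((ProbabilityTheory.cdf μ).right_continuous x).mono Set.Ioi_subset_Ici_self
  refine ge_of_tendsto hcont ?_
  filter_upwards [self_mem_nhdsWithin] with y hy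
  obtain ⟨z, hz, hzy⟩ := exists_lt_of_csInf_lt hne (lt_of_le_of_lt hx hy)
  exact le_trans hz (ProbabilityTheory.monotone_cdf μ hzy.le)

lemma monotoneOn_leftQuantile : MonotoneOn (leftQuantile μ) (Set.Ioo 0 1) := fun _ hs _ ht hst =>
  (leftQuantile_le_iff μ hs _).2 (hst.trans ((leftQuantile_le_iff μ ht _).1 le_rfl))

lemma MonotoneOn.aemeasurable_unif01 {g : ℝ → ℝ} (hg : MonotoneOn g (Set.Ioo 0 1)) :
    AEMeasurable g unif01 :=
  aemeasurable_restrict_of_monotoneOn measurableSet_Ioo hg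

lemma map_leftQuantile_unif01 : unif01.map (leftQuantile μ) = μ := by
  have hm := (monotoneOn_leftQuantile μ).aemeasurable_unif01
  have := Measure.isProbabilityMeasure_map hm
  refine Measure.ext_of_Iic _ _ fun x => ?_
  rw [Measure.map_apply_of_aemeasurable hm measurableSet_Iic, unif01,
    Measure.restrict_apply' measurableSet_Ioo, ← ProbabilityTheory.ofReal_cdf]
  have h1 := ProbabilityTheory.cdf_le_one μ x
  have h0 := ProbabilityTheory.cdf_nonneg μ x
  have hset : leftQuantile μ ⁻¹' Set.Iic x ∩ Set.Ioo 0 1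
      = Set.Iic (ProbabilityTheory.cdf μ x) ∩ Set.Ioo 0 1 := by
    ext s
    simp only [mem_inter_iff, mem_preimage, mem_Iic]
    exact and_congr_left fun hs => leftQuantile_le_iff μ hs x
  rw [hset]
  apply le_antisymm
  · calc volume (Set.Iic (ProbabilityTheory.cdf μ x) ∩ Set.Ioo 0 1)
        ≤ volume (Set.Ioc 0 (ProbabilityTheory.cdf μ x)) :=
          measure_mono fun s hs => ⟨hs.2.1, hs.1⟩
      _ = _ := by simp
  · calc ENNReal.ofReal (ProbabilityTheory.cdf μ x)
        = volume (Set.Ioo 0 (ProbabilityTheory.cdf μ x)) := by simp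
      _ ≤ volume (Set.Iic (ProbabilityTheory.cdf μ x) ∩ Set.Ioo 0 1) :=
          measure_mono fun s hs => ⟨hs.2.le, hs.1, hs.2.trans_le h1⟩

lemma leftQuantile_nonneg_ae (h : ∀ᵐ x ∂μ, 0 ≤ x) : ∀ᵐ s ∂unif01, 0 ≤ leftQuantile μ s := by
  refine ae_of_ae_map (p := fun x => 0 ≤ x) (monotoneOn_leftQuantile μ).aemeasurable_unif01 ?_
  rwa [map_leftQuantile_unif01]

end Quantile

/-- A randomised distributional transform: a joint law of a uniform variable `U` and a variable
`w ∼ P` such that `Z w` is the quantile function of `Z` evaluated at `U`. -/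
lemma exists_quantile_coupling {E : Type*} [MeasurableSpace E] [StandardBorelSpace E]
    (P : Measure E) [IsProbabilityMeasure P] {Z : E → ℝ} (hZ : Measurable Z) :
    ∃ M : Measure (ℝ × E), IsProbabilityMeasure M ∧ M.map Prod.fst = unif01 ∧
      M.map Prod.snd = P ∧ ∀ᵐ w ∂M, Z w.2 = leftQuantile (P.map Z) w.1 := by
  have : Nonempty E := nonempty_of_isProbabilityMeasure P
  set μ := P.map Z
  have : IsProbabilityMeasure μ := Measure.isProbabilityMeasure_map hZ.aemeasurable
  have hpair : Measurable fun e => (Z e, e) := hZ.prodMk measurable_id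
  set ρ := P.map (fun e => (Z e, e)) with hρ
  have : IsProbabilityMeasure ρ := Measure.isProbabilityMeasure_map hpair.aemeasurable
  have hfst : ρ.fst = μ := by
    rw [Measure.fst, hρ, Measure.map_map measurable_fst hpair]; rfl
  have hQ := (monotoneOn_leftQuantile μ).aemeasurable_unif01
  set Q := hQ.mk (leftQuantile μ)
  have hQm : Measurable Q := hQ.measurable_mk
  have hQmap : unif01.map Q = μ := by
    rw [← map_leftQuantile_unif01 μ]
    exact Measure.map_congr hQ.ae_eq_mk.symm
  set κ := ρ.condKernel.comap Q hQm
  set M := unif01.compProd κ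
  have hMfst : M.map Prod.fst = unif01 := Measure.fst_compProd _ _
  have hmeas : Measurable fun w : ℝ × E => (Q w.1, w.2) :=
    (hQm.comp measurable_fst).prodMk measurable_snd
  have hMρ : M.map (fun w => (Q w.1, w.2)) = ρ := by
    have hdis : μ.compProd ρ.condKernel = ρ := hfst ▸ ρ.disintegrate ρ.condKernel
    ext s hs
    rw [Measure.map_apply hmeas hs, Measure.compProd_apply (hmeas hs)]
    conv_rhs => rw [← hdis, Measure.compProd_apply hs, ← hQmap]
    rw [lintegral_map (ProbabilityTheory.Kernel.measurable_kernel_prodMk_left hs) hQm]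
    rfl
  refine ⟨M, inferInstance, hMfst, ?_, ?_⟩
  · have : M.map Prod.snd = (M.map (fun w => (Q w.1, w.2))).map Prod.snd := by
      rw [Measure.map_map measurable_snd hmeas]; rfl
    rw [this, hMρ, hρ, Measure.map_map measurable_snd hpair]
    exact Measure.map_id
  · have h1 : ∀ᵐ w ∂M, Z w.2 = Q w.1 := by
      refine ae_of_ae_map (p := fun z : ℝ × E => Z z.2 = z.1) hmeas.aemeasurable ?_
      rw [hMρ, hρ, ae_map_iff hpair.aemeasurable
        (measurableSet_eq_fun (f := fun z : ℝ × E => Z z.2) (hZ.comp measurable_snd)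
          measurable_fst)]
      simp
    have h2 : ∀ᵐ w ∂M, leftQuantile μ w.1 = Q w.1 := by
      refine ae_of_ae_map (p := fun u => leftQuantile μ u = Q u) measurable_fst.aemeasurable ?_
      rw [hMfst]
      exact hQ.ae_eq_mk
    filter_upwards [h1, h2] with w hw1 hw2
    rw [hw1, hw2]

lemma lintegral_ofReal_mul_ofReal_eq {Ω : Type*} [MeasurableSpace Ω] (M : Measure Ω)
    {Z G : Ω → ℝ} (hZ : AEMeasurable Z M) (hG : AEMeasurable G M) (hZ0 : 0 ≤ᵐ[M] Z)
    (hG0 : 0 ≤ᵐ[M] G) :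
    ∫⁻ ω, ENNReal.ofReal (G ω) * ENNReal.ofReal (Z ω) ∂M
      = ∫⁻ t in Set.Ioi 0, ∫⁻ r in Set.Ioi 0, M ({ω | r < G ω} ∩ {ω | t < Z ω}) := by
  have hac : M.withDensity (fun ω => ENNReal.ofReal (G ω)) ≪ M :=
    withDensity_absolutelyContinuous _ _
  have h1 := lintegral_withDensity_eq_lintegral_mul₀ (μ := M) hG.ennreal_ofReal hZ.ennreal_ofReal
  simp only [Pi.mul_apply] at h1
  rw [← h1, lintegral_eq_lintegral_meas_lt _ (hac.ae_le hZ0) (hZ.mono_ac hac)]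
  refine lintegral_congr fun t => ?_
  have hZt : NullMeasurableSet {ω | t < Z ω} M := nullMeasurableSet_lt aemeasurable_const hZ
  rw [withDensity_apply₀ _ hZt,
    lintegral_eq_lintegral_meas_lt _ (ae_restrict_of_ae hG0) hG.restrict]
  refine lintegral_congr fun r => ?_
  rw [Measure.restrict_apply₀' hZt]

/-- The Hardy–Littlewood rearrangement inequality, with level sets on the right nested. -/
lemma lintegral_mul_le_of_nested {Ω Ω' : Type*} [MeasurableSpace Ω] [MeasurableSpace Ω']
    {M : Measure Ω} {N : Measure Ω'} {Z G : Ω → ℝ} {Z' G' : Ω' → ℝ}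
    (hZ : AEMeasurable Z M) (hG : AEMeasurable G M)
    (hZ' : AEMeasurable Z' N) (hG' : AEMeasurable G' N)
    (hZ0 : 0 ≤ᵐ[M] Z) (hG0 : 0 ≤ᵐ[M] G) (hZ0' : 0 ≤ᵐ[N] Z') (hG0' : 0 ≤ᵐ[N] G')
    (hZZ : M.map Z = N.map Z') (hGG : M.map G = N.map G')
    (hnest : ∀ t r, {ω | t < Z' ω} ≤ᵐ[N] {ω | r < G' ω} ∨ {ω | r < G' ω} ≤ᵐ[N] {ω | t < Z' ω}) :
    ∫⁻ ω, ENNReal.ofReal (G ω) * ENNReal.ofReal (Z ω) ∂M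
      ≤ ∫⁻ ω, ENNReal.ofReal (G' ω) * ENNReal.ofReal (Z' ω) ∂N := by
  rw [lintegral_ofReal_mul_ofReal_eq M hZ hG hZ0 hG0,
    lintegral_ofReal_mul_ofReal_eq N hZ' hG' hZ0' hG0']
  refine lintegral_mono fun t => lintegral_mono fun r => ?_
  have hZt : M {ω | t < Z ω} = N {ω | t < Z' ω} := by
    have := congrArg (fun ν => ν (Set.Ioi t)) hZZ
    simpa only [Measure.map_apply_of_aemeasurable hZ measurableSet_Ioi,
      Measure.map_apply_of_aemeasurable hZ' measurableSet_Ioi] using! this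
  have hGr : M {ω | r < G ω} = N {ω | r < G' ω} := by
    have := congrArg (fun ν => ν (Set.Ioi r)) hGG
    simpa only [Measure.map_apply_of_aemeasurable hG measurableSet_Ioi,
      Measure.map_apply_of_aemeasurable hG' measurableSet_Ioi] using! this
  rcases hnest t r with h | h
  · calc M ({ω | r < G ω} ∩ {ω | t < Z ω}) ≤ M {ω | t < Z ω} := measure_mono inter_subset_right
      _ = N {ω | t < Z' ω} := hZt
      _ ≤ _ := measure_mono_ae (by filter_upwards [h] with ω hω hx using ⟨hω hx, hx⟩)
  · calc M ({ω | r < G ω} ∩ {ω | t < Z ω}) ≤ M {ω | r < G ω} := measure_mono inter_subset_left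
      _ = N {ω | r < G' ω} := hGr
      _ ≤ _ := measure_mono_ae (by filter_upwards [h] with ω hω hx using ⟨hx, hω hx⟩)

lemma lintegral_mul_comp_le_quantile {Ω : Type*} [MeasurableSpace Ω] {M : Measure Ω}
    [IsProbabilityMeasure M] {U Z : Ω → ℝ} (hU : Measurable U) (hUM : M.map U = unif01)
    (hZ : Measurable Z) (hZ0 : 0 ≤ Z) {g : ℝ → ℝ} (hg : MonotoneOn g (Set.Ioo 0 1))
    (hg0 : ∀ s ∈ Set.Ioo (0 : ℝ) 1, 0 ≤ g s) :
    ∫⁻ ω, ENNReal.ofReal (g (U ω)) * ENNReal.ofReal (Z ω) ∂M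
      ≤ ∫⁻ s, ENNReal.ofReal (g s) * ENNReal.ofReal (leftQuantile (M.map Z) s) ∂unif01 := by
  have : IsProbabilityMeasure (M.map Z) := Measure.isProbabilityMeasure_map hZ.aemeasurable
  have hgm : AEMeasurable g (M.map U) := hUM ▸ hg.aemeasurable_unif01
  have hg0ae : 0 ≤ᵐ[unif01] g := ae_unif01_mem.mono hg0
  refine lintegral_mul_le_of_nested hZ.aemeasurable (hgm.comp_measurable hU)
    (monotoneOn_leftQuantile _).aemeasurable_unif01 hg.aemeasurable_unif01
    (.of_forall hZ0) ?_ ?_ hg0ae ?_ ?_ ?_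
  · exact ae_of_ae_map (p := fun u => 0 ≤ g u) hU.aemeasurable (hUM ▸ hg0ae)
  · refine leftQuantile_nonneg_ae _ ?_
    rw [ae_map_iff hZ.aemeasurable measurableSet_Ici]
    exact .of_forall hZ0
  · rw [map_leftQuantile_unif01]
  · rw [← hUM]
    exact (AEMeasurable.map_map_of_aemeasurable hgm hU.aemeasurable).symm
  · intro t r
    by_cases h : ∃ s ∈ Set.Ioo (0 : ℝ) 1, t < leftQuantile (M.map Z) s ∧ g s ≤ r
    · right
      obtain ⟨s, hs, hts, hsr⟩ := h
      filter_upwards [ae_unif01_mem] with u hu hru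
      have hsu : s ≤ u := by
        by_contra! hus
        exact absurd ((hg hu hs hus.le).trans hsr) (not_le.2 hru)
      exact hts.trans_le (monotoneOn_leftQuantile _ hs hu hsu)
    · left
      push Not at h
      filter_upwards [ae_unif01_mem] with u hu htu
      exact h u hu htu

section LeftDeriv

variable {h : ℝ → ℝ}

lemma monotoneOn_leftDeriv_Ioo (hconv : ConvexOn ℝ (Set.Icc 0 1) h) :
    MonotoneOn (leftDeriv h) (Set.Ioo 0 1) := by
  have := hconv.monotoneOn_leftDeriv
  rwa [interior_Icc] at this

lemma leftDeriv_nonneg (hmono : MonotoneOn h (Set.Icc 0 1)) :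
    ∀ s ∈ Set.Ioo (0 : ℝ) 1, 0 ≤ leftDeriv h s := by
  intro s hs
  have h1 : leftDeriv h s = derivWithin h (Set.Iio s ∩ Set.Ioo 0 1) s :=
    (derivWithin_inter (isOpen_Ioo.mem_nhds hs)).symm
  rw [h1]
  exact (hmono.mono fun x hx => ⟨hx.2.1.le, hx.2.2.le⟩).derivWithin_nonneg

end LeftDeriv

section Holder

lemma lintegral_ofReal_mul_le_eLpNorm_mul {Ω : Type*} [MeasurableSpace Ω] {M : Measure Ω}
    {p q : ℝ≥0∞} (hpq : p⁻¹ + q⁻¹ = 1) {f g : Ω → ℝ} (hf : AEStronglyMeasurable f M)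
    (hg : AEStronglyMeasurable g M) :
    ∫⁻ ω, ENNReal.ofReal (g ω) * ENNReal.ofReal (f ω) ∂M ≤ eLpNorm g q M * eLpNorm f p M := by
  have : ENNReal.HolderTriple q p 1 := ⟨by rw [add_comm, hpq, inv_one]⟩
  refine le_trans ?_ (eLpNorm_smul_le_mul_eLpNorm (r := 1) hf hg)
  rw [eLpNorm_one_eq_lintegral_enorm]
  refine lintegral_mono fun ω => ?_
  rw [Pi.smul_apply', smul_eq_mul, enorm_mul]
  exact mul_le_mul' (Real.ofReal_le_enorm _) (Real.ofReal_le_enorm _)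

/-- Near-extremal functions in Hölder's inequality. -/
lemma exists_lintegral_mul_gt {p q : ℝ≥0∞} (hp : 1 ≤ p) (hpq : p⁻¹ + q⁻¹ = 1) {g : ℝ → ℝ}
    (hg : AEMeasurable g unif01) (hg0 : 0 ≤ᵐ[unif01] g) (hfin : eLpNorm g q unif01 ≠ ∞)
    {c : ℝ≥0∞} (hc : c < eLpNorm g q unif01) :
    ∃ T : ℝ → ℝ, Measurable T ∧ 0 ≤ T ∧ eLpNorm T p unif01 ≤ 1 ∧
      c ≤ ∫⁻ s, ENNReal.ofReal (g s) * ENNReal.ofReal (T s) ∂unif01 := by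
  have hen : ∀ᵐ s ∂unif01, ‖g s‖ₑ = ENNReal.ofReal (g s) := by
    filter_upwards [hg0] with s hs using Real.enorm_of_nonneg hs
  rcases eq_or_ne p ∞ with rfl | hptop
  · have hq : q = 1 := by simpa using hpq
    subst hq
    refine ⟨fun _ => 1, measurable_const, fun _ => zero_le_one, ?_, ?_⟩
    · rw [eLpNorm_exponent_top]
      exact essSup_le_of_ae_le _ (.of_forall fun _ => by simp)
    · rw [eLpNorm_one_eq_lintegral_enorm, lintegral_congr_ae hen] at hc
      simpa using hc.le
  rcases eq_or_ne p 1 with rfl | hp1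
  · have hq : q = ∞ := by
      have : (1 : ℝ≥0∞) + q⁻¹ = 1 + 0 := by simpa using hpq
      simpa using (ENNReal.add_right_inj ENNReal.one_ne_top).1 this
    subst hq
    have hgm : Measurable (hg.mk g) := hg.measurable_mk
    set A := {s | c < ENNReal.ofReal (hg.mk g s)} with hA
    have hAm : MeasurableSet A := measurableSet_lt measurable_const hgm.ennreal_ofReal
    have hA0 : unif01 A ≠ 0 := by
      intro h0
      refine absurd hc (not_lt.2 ?_)
      rw [eLpNorm_exponent_top]
      refine essSup_le_of_ae_le _ ?_
      have : ∀ᵐ s ∂unif01, s ∉ A := measure_eq_zero_iff_ae_notMem.1 h0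
      filter_upwards [this, hen, hg.ae_eq_mk] with s hs hs2 hs3
      rw [hs2, hs3]
      exact not_lt.1 hs
    have hAtop : unif01 A ≠ ∞ := measure_ne_top _ _
    set a := (unif01 A).toReal
    have hapos : 0 < a := ENNReal.toReal_pos hA0 hAtop
    have haA : ENNReal.ofReal a = unif01 A := ENNReal.ofReal_toReal hAtop
    have hinv : ENNReal.ofReal a⁻¹ * unif01 A = 1 := by
      rw [ENNReal.ofReal_inv_of_pos hapos, haA, ENNReal.inv_mul_cancel hA0 hAtop]
    refine ⟨A.indicator fun _ => a⁻¹, measurable_const.indicator hAm,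
      indicator_nonneg fun _ _ => by positivity, ?_, ?_⟩
    · rw [eLpNorm_indicator_const hAm one_ne_zero ENNReal.one_ne_top]
      simp only [ENNReal.toReal_one, div_one, ENNReal.rpow_one]
      rw [Real.enorm_of_nonneg (by positivity), hinv]
    · calc c = ∫⁻ s in A, c * ENNReal.ofReal a⁻¹ ∂unif01 := by
            rw [setLIntegral_const, mul_assoc, hinv, mul_one]
        _ ≤ ∫⁻ s in A, ENNReal.ofReal (g s) * ENNReal.ofReal a⁻¹ ∂unif01 := by
            refine lintegral_mono_ae ?_
            filter_upwards [ae_restrict_mem hAm, ae_restrict_of_ae hg.ae_eq_mk] with s hs hs2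
            rw [hs2]
            exact mul_le_mul_left (le_of_lt hs) _
        _ = ∫⁻ s, ENNReal.ofReal (g s) * ENNReal.ofReal (A.indicator (fun _ => a⁻¹) s) ∂unif01 := by
            rw [← lintegral_indicator hAm]
            refine lintegral_congr fun s => ?_
            by_cases hs : s ∈ A <;> simp [hs]
  · have hp0 : p ≠ 0 := fun h => by simp [h] at hp
    have hq0 : q ≠ 0 := by rintro rfl; simp at hpq
    have hqtop : q ≠ ∞ := by rintro rfl; simp at hpq; exact hp1 hpq
    have hconj : p.toReal.HolderConjugate q.toReal := by
      rw [Real.holderConjugate_iff]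
      constructor
      · have : 1 < p := lt_of_le_of_ne hp (Ne.symm hp1)
        simpa using (ENNReal.toReal_lt_toReal ENNReal.one_ne_top hptop).2 this
      · rw [← ENNReal.toReal_inv, ← ENNReal.toReal_inv,
          ← ENNReal.toReal_add (by simpa) (by simpa), hpq, ENNReal.toReal_one]
    set P := p.toReal
    set R := q.toReal
    have hR0 : 0 < R := hconj.symm.pos
    have hR1 : 0 < R - 1 := hconj.symm.sub_one_pos
    have hPR : (R - 1) * P = R := by
      have := hconj.symm.sub_one_mul_conj
      exact this
    set K := (eLpNorm g q unif01).toReal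
    have hKK : ENNReal.ofReal K = eLpNorm g q unif01 := ENNReal.ofReal_toReal hfin
    have hKpos : 0 < K := ENNReal.toReal_pos (pos_of_gt hc).ne' hfin
    have hgR : ∫⁻ s, ENNReal.ofReal (g s) ^ R ∂unif01 = ENNReal.ofReal K ^ R := by
      rw [hKK, eLpNorm_eq_lintegral_rpow_enorm_toReal hq0 hqtop, ← ENNReal.rpow_mul,
        one_div_mul_cancel hR0.ne', ENNReal.rpow_one]
      refine lintegral_congr_ae ?_
      filter_upwards [hen] with s hs
      rw [hs]
    have hgm : Measurable (hg.mk g) := hg.measurable_mk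
    set T : ℝ → ℝ := fun s => (max (hg.mk g s) 0 / K) ^ (R - 1) with hT
    have hTm : Measurable T := ((hgm.max measurable_const).div_const K).pow_const _
    have hT0 : 0 ≤ T := fun s => by simp only [hT, Pi.zero_apply]; positivity
    have hTe : ∀ᵐ s ∂unif01, ENNReal.ofReal (T s)
        = (ENNReal.ofReal (g s) * (ENNReal.ofReal K)⁻¹) ^ (R - 1) := by
      filter_upwards [hg0, hg.ae_eq_mk] with s hs hs2
      have hs' : 0 ≤ g s := hs
      simp only [hT]
      rw [← hs2, max_eq_left hs', ← ENNReal.ofReal_rpow_of_nonneg (by positivity) hR1.le,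
        ENNReal.ofReal_div_of_pos hKpos, div_eq_mul_inv]
    have hK0 : ENNReal.ofReal K ≠ 0 := by simpa using hKpos
    refine ⟨T, hTm, hT0, ?_, ?_⟩
    · rw [eLpNorm_eq_lintegral_rpow_enorm_toReal hp0 hptop]
      refine (ENNReal.rpow_le_one ?_ (by positivity))
      calc ∫⁻ s, ‖T s‖ₑ ^ P ∂unif01
          = ∫⁻ s, ENNReal.ofReal (g s) ^ R * (ENNReal.ofReal K)⁻¹ ^ R ∂unif01 := by
            refine lintegral_congr_ae ?_
            filter_upwards [hTe] with s hs
            rw [Real.enorm_of_nonneg (hT0 s), hs, ← ENNReal.rpow_mul, hPR,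
              ENNReal.mul_rpow_of_nonneg _ _ hR0.le]
        _ ≤ 1 := by
            rw [lintegral_mul_const' _ _ (by simp [hKpos]), hgR,
              ← ENNReal.mul_rpow_of_nonneg _ _ hR0.le,
              ENNReal.mul_inv_cancel hK0 ENNReal.ofReal_ne_top, ENNReal.one_rpow]
    · refine hc.le.trans (le_of_eq ?_)
      calc eLpNorm g q unif01 = ENNReal.ofReal K ^ R * (ENNReal.ofReal K)⁻¹ ^ (R - 1) := by
            rw [← hKK, ENNReal.inv_rpow, ← ENNReal.rpow_neg,
              ← ENNReal.rpow_add _ _ hK0 ENNReal.ofReal_ne_top]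
            ring_nf
            rw [ENNReal.rpow_one]
        _ = ∫⁻ s, ENNReal.ofReal (g s) ^ R * (ENNReal.ofReal K)⁻¹ ^ (R - 1) ∂unif01 := by
            rw [lintegral_mul_const' _ _ (by simp [hKpos]), hgR]
        _ = _ := by
            refine lintegral_congr_ae ?_
            filter_upwards [hTe] with s hs
            rw [hs, ENNReal.mul_rpow_of_nonneg _ _ hR1.le, ← mul_assoc]
            congr 1
            nth_rewrite 2 [← ENNReal.rpow_one (ENNReal.ofReal (g s))]
            rw [← ENNReal.rpow_add_of_nonneg _ _ zero_le_one hR1.le]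
            ring_nf

end Holder

section Norms

variable {n : ℕ} {nrm : Vec n → ℝ}

namespace IsNorm

lemma map_zero (hn : IsNorm nrm) : nrm 0 = 0 := (hn.1 0).2 rfl

lemma nonneg (hn : IsNorm nrm) (x : Vec n) : 0 ≤ nrm x := by
  have h1 := hn.2.2 x ((-1 : ℝ) • x)
  rw [hn.2.1] at h1
  simp [hn.map_zero] at h1
  linarith

lemma map_neg (hn : IsNorm nrm) (x : Vec n) : nrm (-x) = nrm x := by
  have := hn.2.1 (-1) x
  simpa using this

lemma exists_le_mul_norm (hn : IsNorm nrm) : ∃ C, ∀ x, nrm x ≤ C * ‖x‖ := by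
  refine ⟨∑ i, nrm (Pi.single i 1), fun x => ?_⟩
  have hsum : ∀ s : Finset (Fin n), nrm (∑ i ∈ s, x i • Pi.single i (1 : ℝ))
      ≤ ∑ i ∈ s, nrm (x i • Pi.single i (1 : ℝ)) := by
    intro s
    induction s using Finset.cons_induction with
    | empty => simp [hn.map_zero]
    | cons a s ha ih =>
      rw [Finset.sum_cons, Finset.sum_cons]
      exact (hn.2.2 _ _).trans (by gcongr)
  have hx : ∑ i, x i • (Pi.single i (1 : ℝ) : Vec n) = x := by
    ext j
    simp [Finset.sum_apply, Pi.single_apply]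
  calc nrm x = nrm (∑ i, x i • (Pi.single i (1 : ℝ) : Vec n)) := by rw [hx]
    _ ≤ ∑ i, nrm (x i • Pi.single i (1 : ℝ)) := hsum _
    _ ≤ ∑ i, ‖x‖ * nrm (Pi.single i 1) := by
        refine Finset.sum_le_sum fun i _ => ?_
        rw [hn.2.1]
        exact mul_le_mul_of_nonneg_right (norm_le_pi_norm x i) (hn.nonneg _)
    _ = _ := by rw [← Finset.mul_sum, mul_comm]

lemma continuous (hn : IsNorm nrm) : Continuous nrm := by
  obtain ⟨C, hC⟩ := hn.exists_le_mul_norm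
  refine (LipschitzWith.of_dist_le' (K := C) fun x y => ?_).continuous
  rw [Real.dist_eq, dist_eq_norm, abs_le]
  have h1 := hn.2.2 (x - y) y
  have h2 := hn.2.2 (y - x) x
  have h3 := hC (x - y)
  have h4 : nrm (y - x) = nrm (x - y) := by rw [← hn.map_neg, neg_sub]
  simp only [sub_add_cancel] at h1 h2
  constructor <;> linarith

lemma exists_norm_le_mul (hn : IsNorm nrm) : ∃ C, 0 < C ∧ ∀ x, ‖x‖ ≤ C * nrm x := by
  rcases (Metric.sphere (0 : Vec n) 1).eq_empty_or_nonempty with he | hne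
  · refine ⟨1, one_pos, fun x => ?_⟩
    by_cases hx : x = 0
    · simp [hx, hn.map_zero]
    · have : ‖x‖⁻¹ • x ∈ Metric.sphere (0 : Vec n) 1 := by
        simp [norm_smul, norm_ne_zero_iff.2 hx]
      simp [he] at this
  · obtain ⟨z, hz, hmin⟩ := (isCompact_sphere (0 : Vec n) 1).exists_isMinOn hne
      hn.continuous.continuousOn
    have hz0 : z ≠ 0 := by
      rintro rfl
      simp at hz
    have hpos : 0 < nrm z := lt_of_le_of_ne (hn.nonneg z) fun h => hz0 ((hn.1 z).1 h.symm)
    refine ⟨(nrm z)⁻¹, inv_pos.2 hpos, fun x => ?_⟩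
    by_cases hx : x = 0
    · simp [hx, hn.map_zero]
    · have hx' : 0 < ‖x‖ := norm_pos_iff.2 hx
      have : ‖x‖⁻¹ • x ∈ Metric.sphere (0 : Vec n) 1 := by
        simp [norm_smul, hx'.ne']
      have := hmin this
      simp only [mem_ofPred_eq, hn.2.1, abs_inv, abs_norm] at this
      rw [inv_mul_eq_div, le_div_iff₀ hx'] at this
      rw [inv_mul_eq_div, le_div_iff₀ hpos]
      linarith

end IsNorm

lemma continuous_dotp (β : Vec n) : Continuous (dotp β) := by
  unfold dotp
  fun_prop

lemma dotp_smul (β : Vec n) (c : ℝ) (x : Vec n) : dotp β (c • x) = c * dotp β x := by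
  simp only [dotp, Finset.mul_sum, Pi.smul_apply, smul_eq_mul]
  exact Finset.sum_congr rfl fun i _ => by ring

lemma dotp_add (β x y : Vec n) : dotp β (x + y) = dotp β x + dotp β y := by
  simp [dotp, mul_add, Finset.sum_add_distrib]

lemma dotp_sub (β x y : Vec n) : dotp β (x - y) = dotp β x - dotp β y := by
  simp [dotp, mul_sub, Finset.sum_sub_distrib]

/-- The supremum defining the dual norm is attained. -/
lemma exists_isGreatest_dualNorm (hn : IsNorm nrm) (β : Vec n) :
    ∃ v, nrm v ≤ 1 ∧ dotp β v = dualNorm nrm β ∧ ∀ x, nrm x ≤ 1 → dotp β x ≤ dualNorm nrm β := by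
  obtain ⟨C, hC, hle⟩ := hn.exists_norm_le_mul
  have hcpt : IsCompact {x | nrm x ≤ 1} := by
    refine (isCompact_closedBall (0 : Vec n) C).of_isClosed_subset
      (isClosed_le hn.continuous continuous_const) fun x hx => ?_
    rw [mem_closedBall_zero_iff]
    exact (hle x).trans (mul_le_of_le_one_right hC.le hx)
  obtain ⟨v, hv, hmax⟩ := hcpt.exists_isMaxOn ⟨0, by simp [hn.map_zero]⟩
    (continuous_dotp β).continuousOn
  have hg : IsGreatest {r | ∃ x, nrm x ≤ 1 ∧ r = dotp β x} (dotp β v) := by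
    refine ⟨⟨v, hv, rfl⟩, ?_⟩
    rintro r ⟨x, hx, rfl⟩
    exact hmax hx
  have heq : dualNorm nrm β = dotp β v := hg.csSup_eq
  exact ⟨v, hv, heq.symm, fun x hx => heq ▸ hmax hx⟩

lemma dualNorm_nonneg (hn : IsNorm nrm) (β : Vec n) : 0 ≤ dualNorm nrm β := by
  obtain ⟨v, -, -, hmax⟩ := exists_isGreatest_dualNorm hn β
  simpa [dotp] using hmax 0 (by simp [hn.map_zero])

lemma dotp_le_dualNorm_mul (hn : IsNorm nrm) (β x : Vec n) :
    dotp β x ≤ dualNorm nrm β * nrm x := by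
  obtain ⟨v, -, -, hmax⟩ := exists_isGreatest_dualNorm hn β
  by_cases hx : x = 0
  · simp [hx, hn.map_zero, dotp]
  · have hpos : 0 < nrm x := lt_of_le_of_ne (hn.nonneg x) fun h => hx ((hn.1 x).1 h.symm)
    have := hmax ((nrm x)⁻¹ • x) (by rw [hn.2.1, abs_inv, abs_of_pos hpos, inv_mul_cancel₀ hpos.ne'])
    rwa [dotp_smul, inv_mul_eq_div, div_le_iff₀ hpos] at this

lemma abs_dotp_le_dualNorm_mul (hn : IsNorm nrm) (β x : Vec n) :
    |dotp β x| ≤ dualNorm nrm β * nrm x := by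
  refine abs_le'.2 ⟨dotp_le_dualNorm_mul hn β x, ?_⟩
  have := dotp_le_dualNorm_mul hn β (-x)
  rw [hn.map_neg] at this
  simpa [dotp] using this

end Norms

section Main

/-- The distortion functional of a distribution on `[0,∞)`, valued in `ℝ≥0∞`. -/
def lDistortion (h : ℝ → ℝ) (μ : Measure ℝ) : ℝ≥0∞ :=
  ∫⁻ s, ENNReal.ofReal (leftDeriv h s) * ENNReal.ofReal (leftQuantile μ s) ∂unif01

lemma distortion_eq_toReal {h : ℝ → ℝ} (hmono : MonotoneOn h (Set.Icc 0 1))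
    (hconv : ConvexOn ℝ (Set.Icc 0 1) h) (μ : Measure ℝ) [IsProbabilityMeasure μ]
    (hμ : ∀ᵐ x ∂μ, 0 ≤ x) : distortion h μ = (lDistortion h μ).toReal := by
  rw [distortion, intervalIntegral.integral_of_le zero_le_one, integral_Ioc_eq_integral_Ioo]
  change ∫ s, leftQuantile μ s * leftDeriv h s ∂unif01 = _
  have hQ := leftQuantile_nonneg_ae μ hμ
  have hg := ae_unif01_mem.mono (leftDeriv_nonneg hmono)
  have hmeas : AEMeasurable (fun s => leftQuantile μ s * leftDeriv h s) unif01 :=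
    (monotoneOn_leftQuantile μ).aemeasurable_unif01.mul
      (monotoneOn_leftDeriv_Ioo hconv).aemeasurable_unif01
  rw [integral_eq_lintegral_of_nonneg_ae _ hmeas.aestronglyMeasurable, lDistortion]
  · congr 1
    refine lintegral_congr_ae ?_
    filter_upwards [hg] with s hs
    rw [ENNReal.ofReal_mul' hs, mul_comm]
  · filter_upwards [hQ, hg] with s h1 h2 using mul_nonneg h1 h2

variable {n : ℕ} {nrm : Vec n → ℝ}

lemma eLpNorm_nrm_comp {Ω : Type*} [MeasurableSpace Ω] (hn : IsNorm nrm) {p : ℝ≥0∞} (hp : 1 ≤ p)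
    (μ : Measure Ω) (X : Ω → Vec n) :
    eLpNorm (fun ω => nrm (X ω)) p μ = if p = ∞ then essSup (fun ω => ENNReal.ofReal (nrm (X ω))) μ
      else (∫⁻ ω, ENNReal.ofReal (nrm (X ω)) ^ p.toReal ∂μ) ^ (1 / p.toReal) := by
  have he : ∀ x, ‖nrm x‖ₑ = ENNReal.ofReal (nrm x) := fun x => Real.enorm_of_nonneg (hn.nonneg x)
  split_ifs with h
  · simp only [h, eLpNorm_exponent_top, eLpNormEssSup, he]
  · rw [eLpNorm_eq_lintegral_rpow_enorm_toReal (zero_lt_one.trans_le hp).ne' h]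
    simp only [he]

lemma hasMomentP_iff (hn : IsNorm nrm) {p : ℝ≥0∞} (hp : 1 ≤ p) (μ : Measure (Vec n)) :
    HasMomentP nrm p μ ↔ eLpNorm nrm p μ ≠ ∞ := by
  have h1 := eLpNorm_nrm_comp hn hp μ id
  simp only [id] at h1
  rw [HasMomentP, h1]
  split_ifs with h
  · rfl
  · have : 0 < p.toReal := ENNReal.toReal_pos (zero_lt_one.trans_le hp).ne' h
    rw [Ne, Ne, ENNReal.rpow_eq_top_iff_of_pos (by positivity)]

lemma wassersteinD_eq_iInf (hn : IsNorm nrm) {p : ℝ≥0∞} (hp : 1 ≤ p) (μ ν : Measure (Vec n)) :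
    WassersteinD (fun x y => ENNReal.ofReal (nrm (x - y))) p μ ν
      = ⨅ π ∈ Couplings μ ν, eLpNorm (fun z : Vec n × Vec n => nrm (z.1 - z.2)) p π := by
  rw [WassersteinD]
  split_ifs with h <;>
  · refine iInf_congr fun π => iInf_congr fun _ => ?_
    rw [eLpNorm_nrm_comp hn hp]
    simp [h]

lemma wassersteinD_map_le {Ω : Type*} [MeasurableSpace Ω] (hn : IsNorm nrm) {p : ℝ≥0∞}
    (hp : 1 ≤ p) (M : Measure Ω) [IsProbabilityMeasure M] {X Y : Ω → Vec n} (hX : Measurable X)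
    (hY : Measurable Y) :
    WassersteinD (fun x y => ENNReal.ofReal (nrm (x - y))) p (M.map X) (M.map Y)
      ≤ eLpNorm (fun ω => nrm (X ω - Y ω)) p M := by
  rw [wassersteinD_eq_iInf hn hp]
  have hpair : Measurable fun ω => (X ω, Y ω) := hX.prodMk hY
  have hsub : Measurable fun z : Vec n × Vec n => nrm (z.1 - z.2) :=
    hn.continuous.measurable.comp (measurable_fst.sub measurable_snd)
  have hmem : M.map (fun ω => (X ω, Y ω)) ∈ Couplings (M.map X) (M.map Y) := by
    refine ⟨Measure.isProbabilityMeasure_map hpair.aemeasurable, ?_, ?_⟩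
    · rw [Measure.map_map measurable_fst hpair]
      rfl
    · rw [Measure.map_map measurable_snd hpair]
      rfl
  refine (iInf₂_le _ hmem).trans (le_of_eq ?_)
  rw [eLpNorm_map_measure hsub.aestronglyMeasurable hpair.aemeasurable]
  rfl

lemma eLpNorm_comp_eq {Ω : Type*} [MeasurableSpace Ω] {M : Measure Ω} {U : Ω → ℝ}
    (hU : Measurable U) (hUM : M.map U = unif01) {g : ℝ → ℝ} (hg : AEMeasurable g unif01)
    (q : ℝ≥0∞) : eLpNorm (fun ω => g (U ω)) q M = eLpNorm g q unif01 := by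
  have := eLpNorm_map_measure (p := q) (hUM ▸ hg.aestronglyMeasurable) hU.aemeasurable
  rw [← hUM, this]
  rfl

variable {h : ℝ → ℝ} {p q : ℝ≥0∞}

/-- The absolute portfolio loss `x ↦ |β^⊤x|`. -/
def absDotp (β x : Vec n) : ℝ := |dotp β x|

lemma measurable_absDotp (β : Vec n) : Measurable (absDotp β) :=
  (continuous_dotp β).abs.measurable

lemma absDotp_nonneg (β : Vec n) : 0 ≤ absDotp β := fun _ => abs_nonneg _

lemma absDotp_le_add (hn : IsNorm nrm) (β x y : Vec n) :
    absDotp β x ≤ absDotp β y + dualNorm nrm β * nrm (x - y) := by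
  have h1 := abs_dotp_le_dualNorm_mul hn β (x - y)
  rw [dotp_sub] at h1
  have h2 := abs_sub_abs_le_abs_sub (dotp β x) (dotp β y)
  simp only [absDotp]
  linarith

lemma distortion_map_absDotp (hmono : MonotoneOn h (Set.Icc 0 1))
    (hconv : ConvexOn ℝ (Set.Icc 0 1) h) (F : Measure (Vec n)) [IsProbabilityMeasure F]
    (β : Vec n) : distortion h (F.map (absDotp β)) = (lDistortion h (F.map (absDotp β))).toReal := by
  have : IsProbabilityMeasure (F.map (absDotp β)) :=
    Measure.isProbabilityMeasure_map (measurable_absDotp β).aemeasurable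
  refine distortion_eq_toReal hmono hconv _ ?_
  rw [ae_map_iff (measurable_absDotp β).aemeasurable measurableSet_Ici]
  exact .of_forall (absDotp_nonneg β)

/-- The distortion functional as an integral over a quantile coupling. -/
lemma lDistortion_eq_lintegral (hconv : ConvexOn ℝ (Set.Icc 0 1) h) {E : Type*}
    [MeasurableSpace E] {P : Measure E} {Z : E → ℝ} {M : Measure (ℝ × E)}
    (hP : IsProbabilityMeasure (P.map Z))
    (hM : M.map Prod.fst = unif01) (hZ : ∀ᵐ w ∂M, Z w.2 = leftQuantile (P.map Z) w.1) :
    lDistortion h (P.map Z)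
      = ∫⁻ w, ENNReal.ofReal (leftDeriv h w.1) * ENNReal.ofReal (Z w.2) ∂M := by
  have hm : AEMeasurable (fun s => ENNReal.ofReal (leftDeriv h s)
      * ENNReal.ofReal (leftQuantile (P.map Z) s)) unif01 :=
    (monotoneOn_leftDeriv_Ioo hconv).aemeasurable_unif01.ennreal_ofReal.mul
      (monotoneOn_leftQuantile _).aemeasurable_unif01.ennreal_ofReal
  rw [lDistortion]
  conv_lhs => rw [← hM]
  rw [lintegral_map' (hM ▸ hm) measurable_fst.aemeasurable]
  refine lintegral_congr_ae ?_
  filter_upwards [hZ] with w hw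
  rw [hw]

lemma lDistortion_le_add (hn : IsNorm nrm) (hmono : MonotoneOn h (Set.Icc 0 1))
    (hconv : ConvexOn ℝ (Set.Icc 0 1) h) (hpq : p⁻¹ + q⁻¹ = 1) {F F₀ : Measure (Vec n)}
    [IsProbabilityMeasure F] {π : Measure (Vec n × Vec n)} (hπ : π ∈ Couplings F F₀) (β : Vec n) :
    lDistortion h (F.map (absDotp β)) ≤ lDistortion h (F₀.map (absDotp β))
      + ENNReal.ofReal (dualNorm nrm β) * (eLpNorm (leftDeriv h) q unif01
        * eLpNorm (fun z : Vec n × Vec n => nrm (z.1 - z.2)) p π) := by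
  obtain ⟨hπp, hπ1, hπ2⟩ := hπ
  have hA := measurable_absDotp β
  have hprob : IsProbabilityMeasure (F.map (absDotp β)) :=
    Measure.isProbabilityMeasure_map hA.aemeasurable
  have hZ : Measurable fun z : Vec n × Vec n => absDotp β z.1 := hA.comp measurable_fst
  obtain ⟨M, hMp, hM1, hM2, hMQ⟩ := exists_quantile_coupling π hZ
  have hmap : π.map (fun z : Vec n × Vec n => absDotp β z.1) = F.map (absDotp β) := by
    rw [← hπ1, Measure.map_map hA measurable_fst]
    rfl
  have hmap2 : M.map (fun w => absDotp β w.2.2) = F₀.map (absDotp β) := by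
    rw [← hπ2, ← hM2, Measure.map_map measurable_snd measurable_snd,
      Measure.map_map hA (measurable_snd.comp measurable_snd)]
    rfl
  have hgm : AEMeasurable (leftDeriv h) unif01 :=
    (monotoneOn_leftDeriv_Ioo hconv).aemeasurable_unif01
  have hgM : AEMeasurable (fun w : ℝ × Vec n × Vec n => leftDeriv h w.1) M :=
    (hM1 ▸ hgm : AEMeasurable (leftDeriv h) (M.map Prod.fst)).comp_measurable measurable_fst
  have hdm : Measurable fun z : Vec n × Vec n => nrm (z.1 - z.2) :=
    hn.continuous.measurable.comp (measurable_fst.sub measurable_snd)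
  have hZ2 : Measurable fun w : ℝ × Vec n × Vec n => absDotp β w.2.2 :=
    hA.comp (measurable_snd.comp measurable_snd)
  have hdM : Measurable fun w : ℝ × Vec n × Vec n => nrm (w.2.1 - w.2.2) :=
    hdm.comp measurable_snd
  have hd : eLpNorm (fun w : ℝ × Vec n × Vec n => nrm (w.2.1 - w.2.2)) p M
      = eLpNorm (fun z : Vec n × Vec n => nrm (z.1 - z.2)) p π := by
    rw [← hM2, eLpNorm_map_measure hdm.aestronglyMeasurable measurable_snd.aemeasurable]
    rfl
  rw [← hmap, lDistortion_eq_lintegral hconv (hmap ▸ hprob) hM1 hMQ]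
  calc ∫⁻ w, ENNReal.ofReal (leftDeriv h w.1) * ENNReal.ofReal (absDotp β w.2.1) ∂M
      ≤ ∫⁻ w, (ENNReal.ofReal (leftDeriv h w.1) * ENNReal.ofReal (absDotp β w.2.2)
          + ENNReal.ofReal (dualNorm nrm β) * (ENNReal.ofReal (leftDeriv h w.1)
            * ENNReal.ofReal (nrm (w.2.1 - w.2.2)))) ∂M := by
        refine lintegral_mono fun w => ?_
        rw [mul_left_comm, ← mul_add, ← ENNReal.ofReal_mul (dualNorm_nonneg hn β),
          ← ENNReal.ofReal_add (absDotp_nonneg β _)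
            (mul_nonneg (dualNorm_nonneg hn β) (hn.nonneg _))]
        gcongr
        exact absDotp_le_add hn β _ _
    _ = ∫⁻ w, ENNReal.ofReal (leftDeriv h w.1) * ENNReal.ofReal (absDotp β w.2.2) ∂M
          + ENNReal.ofReal (dualNorm nrm β) * ∫⁻ w, ENNReal.ofReal (leftDeriv h w.1)
            * ENNReal.ofReal (nrm (w.2.1 - w.2.2)) ∂M := by
        have hm : AEMeasurable (fun w : ℝ × Vec n × Vec n =>
            ENNReal.ofReal (leftDeriv h w.1) * ENNReal.ofReal (absDotp β w.2.2)) M :=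
          hgM.ennreal_ofReal.mul hZ2.aemeasurable.ennreal_ofReal
        rw [lintegral_add_left' hm, lintegral_const_mul' _ _ ENNReal.ofReal_ne_top]
    _ ≤ _ := by
        gcongr
        · rw [← hmap2]
          exact lintegral_mul_comp_le_quantile measurable_fst hM1 hZ2 (fun _ => absDotp_nonneg β _)
            (monotoneOn_leftDeriv_Ioo hconv) (leftDeriv_nonneg hmono)
        · rw [← hd, ← eLpNorm_comp_eq measurable_fst hM1 hgm]
          exact lintegral_ofReal_mul_le_eLpNorm_mul hpq hdM.aestronglyMeasurable
            hgM.aestronglyMeasurable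

lemma lDistortion_ne_top (hn : IsNorm nrm) (hconv : ConvexOn ℝ (Set.Icc 0 1) h)
    (hpq : p⁻¹ + q⁻¹ = 1) (hfin : eLpNorm (leftDeriv h) q unif01 ≠ ∞) {F : Measure (Vec n)}
    [IsProbabilityMeasure F] (hF : eLpNorm nrm p F ≠ ∞) (β : Vec n) :
    lDistortion h (F.map (absDotp β)) ≠ ∞ := by
  have hA := measurable_absDotp β
  have hprob : IsProbabilityMeasure (F.map (absDotp β)) :=
    Measure.isProbabilityMeasure_map hA.aemeasurable
  have hQ := (monotoneOn_leftQuantile (F.map (absDotp β))).aemeasurable_unif01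
  have hQp : eLpNorm (leftQuantile (F.map (absDotp β))) p unif01 = eLpNorm (absDotp β) p F := by
    have h1 := eLpNorm_map_measure (p := p) (g := fun x : ℝ => x) (μ := unif01)
      measurable_id.aestronglyMeasurable hQ
    have h2 := eLpNorm_map_measure (p := p) (g := fun x : ℝ => x) (μ := F)
      measurable_id.aestronglyMeasurable hA.aemeasurable
    rw [map_leftQuantile_unif01] at h1
    exact h1.symm.trans h2
  refine ne_top_of_le_ne_top ?_ (lintegral_ofReal_mul_le_eLpNorm_mul hpq hQ.aestronglyMeasurable
    (monotoneOn_leftDeriv_Ioo hconv).aemeasurable_unif01.aestronglyMeasurable)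
  rw [hQp]
  refine ENNReal.mul_ne_top hfin (ne_top_of_le_ne_top (ENNReal.mul_ne_top ENNReal.ofReal_ne_top hF)
    (eLpNorm_le_mul_eLpNorm_of_ae_le_mul (c := dualNorm nrm β) (.of_forall fun x => ?_) p))
  rw [Real.norm_of_nonneg (absDotp_nonneg β x), Real.norm_of_nonneg (hn.nonneg x)]
  exact abs_dotp_le_dualNorm_mul hn β x

lemma lDistortion_le_of_mem_ball (hn : IsNorm nrm) (hmono : MonotoneOn h (Set.Icc 0 1))
    (hconv : ConvexOn ℝ (Set.Icc 0 1) h) (hp : 1 ≤ p) (hpq : p⁻¹ + q⁻¹ = 1)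
    (hfin : eLpNorm (leftDeriv h) q unif01 ≠ ∞) {F F₀ : Measure (Vec n)} {ε : ℝ}
    (hF : F ∈ WballVec nrm p F₀ ε) (β : Vec n) :
    lDistortion h (F.map (absDotp β)) ≤ lDistortion h (F₀.map (absDotp β))
      + ENNReal.ofReal (dualNorm nrm β) * (eLpNorm (leftDeriv h) q unif01 * ENNReal.ofReal ε) := by
  obtain ⟨hFp, -, hW⟩ := hF
  rw [wassersteinD_eq_iInf hn hp] at hW
  have key : ∀ᶠ c in nhdsWithin (ENNReal.ofReal ε) (Set.Ioi (ENNReal.ofReal ε)),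
      lDistortion h (F.map (absDotp β)) ≤ lDistortion h (F₀.map (absDotp β))
      + ENNReal.ofReal (dualNorm nrm β) * (eLpNorm (leftDeriv h) q unif01 * c) := by
    filter_upwards [self_mem_nhdsWithin] with c hc
    have := lt_of_le_of_lt hW hc
    simp only [iInf_lt_iff] at this
    obtain ⟨π, hπ, hlt⟩ := this
    refine (lDistortion_le_add hn hmono hconv hpq hπ β).trans ?_
    gcongr
  have hne : (nhdsWithin (ENNReal.ofReal ε) (Set.Ioi (ENNReal.ofReal ε))).NeBot :=
    nhdsGT_neBot_of_exists_gt ⟨∞, ENNReal.ofReal_lt_top⟩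
  refine ge_of_tendsto (Filter.Tendsto.mono_left ?_ nhdsWithin_le_nhds) key
  refine tendsto_const_nhds.add (ENNReal.Tendsto.const_mul (ENNReal.Tendsto.const_mul
    Filter.tendsto_id (.inr hfin)) (.inr ENNReal.ofReal_ne_top))

/-- Shifting the reference distribution comonotonically along an extremal direction of the dual
norm. -/
lemma exists_mem_ball_lDistortion_ge (hn : IsNorm nrm) (hmono : MonotoneOn h (Set.Icc 0 1))
    (hconv : ConvexOn ℝ (Set.Icc 0 1) h) (hp : 1 ≤ p) {F₀ : Measure (Vec n)}
    [IsProbabilityMeasure F₀] (hmom : eLpNorm nrm p F₀ ≠ ∞) {ε : ℝ} {T : ℝ → ℝ}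
    (hT : Measurable T) (hT0 : 0 ≤ T) (hTε : eLpNorm T p unif01 ≤ ENNReal.ofReal ε) (β : Vec n) :
    ∃ F ∈ WballVec nrm p F₀ ε, lDistortion h (F₀.map (absDotp β)) + ENNReal.ofReal (dualNorm nrm β)
      * ∫⁻ s, ENNReal.ofReal (leftDeriv h s) * ENNReal.ofReal (T s) ∂unif01
        ≤ lDistortion h (F.map (absDotp β)) := by
  have hA := measurable_absDotp β
  have hprob : IsProbabilityMeasure (F₀.map (absDotp β)) :=
    Measure.isProbabilityMeasure_map hA.aemeasurable
  obtain ⟨M, hMp, hM1, hM2, hMQ⟩ := exists_quantile_coupling F₀ hA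
  obtain ⟨v, hv1, hvβ, -⟩ := exists_isGreatest_dualNorm hn β
  have hb := dualNorm_nonneg hn β
  set σ : Vec n → ℝ := fun x => if 0 ≤ dotp β x then 1 else -1 with hσ
  have hσm : Measurable σ :=
    Measurable.ite (measurableSet_le measurable_const (continuous_dotp β).measurable)
      measurable_const measurable_const
  have hσ1 : ∀ x, |σ x| = 1 := fun x => by
    simp only [hσ]; split_ifs <;> simp
  set Y : ℝ × Vec n → Vec n := fun w => w.2 + (T w.1 * σ w.2) • v with hY
  have hYm : Measurable Y :=
    measurable_snd.add (((hT.comp measurable_fst).mul (hσm.comp measurable_snd)).smul_const v)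
  have hYabs : ∀ w, absDotp β (Y w) = absDotp β w.2 + dualNorm nrm β * T w.1 := by
    intro w
    have hTb : 0 ≤ T w.1 * dualNorm nrm β := mul_nonneg (hT0 _) hb
    simp only [absDotp, hY, hσ, dotp_add, dotp_smul, hvβ]
    split_ifs with hs
    · rw [abs_of_nonneg hs, abs_of_nonneg (by linarith)]
      ring
    · rw [abs_of_neg (not_le.1 hs), abs_of_neg (by linarith [not_le.1 hs])]
      ring
  have hYd : ∀ w, nrm (Y w - w.2) ≤ T w.1 := by
    intro w
    simp only [hY, add_sub_cancel_left, hn.2.1, abs_mul, hσ1, mul_one]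
    rw [abs_of_nonneg (hT0 _)]
    exact mul_le_of_le_one_right (hT0 _) hv1
  have hgm : AEMeasurable (leftDeriv h) unif01 :=
    (monotoneOn_leftDeriv_Ioo hconv).aemeasurable_unif01
  have hgM : AEMeasurable (fun w : ℝ × Vec n => leftDeriv h w.1) M :=
    (hM1 ▸ hgm : AEMeasurable (leftDeriv h) (M.map Prod.fst)).comp_measurable measurable_fst
  have hTM : eLpNorm (fun w : ℝ × Vec n => T w.1) p M ≤ ENNReal.ofReal ε := by
    rwa [eLpNorm_comp_eq measurable_fst hM1 hT.aemeasurable]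
  have hdiff : eLpNorm (fun w : ℝ × Vec n => nrm (Y w - w.2)) p M ≤ ENNReal.ofReal ε := by
    refine le_trans (eLpNorm_mono_real fun w => ?_) hTM
    rw [Real.norm_of_nonneg (hn.nonneg _)]
    exact hYd w
  have hnm : Measurable nrm := hn.continuous.measurable
  refine ⟨M.map Y, ⟨Measure.isProbabilityMeasure_map hYm.aemeasurable, ?_, ?_⟩, ?_⟩
  · rw [hasMomentP_iff hn hp, eLpNorm_map_measure hnm.aestronglyMeasurable hYm.aemeasurable]
    have h2 : eLpNorm (fun w : ℝ × Vec n => nrm w.2) p M = eLpNorm nrm p F₀ := by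
      rw [← hM2, eLpNorm_map_measure hnm.aestronglyMeasurable measurable_snd.aemeasurable]
      rfl
    have hsum : eLpNorm (fun w : ℝ × Vec n => nrm w.2 + T w.1) p M ≠ ∞ :=
      ne_top_of_le_ne_top (ENNReal.add_ne_top.2 ⟨by rwa [h2],
        ne_top_of_le_ne_top ENNReal.ofReal_ne_top hTM⟩)
        (eLpNorm_add_le (f := fun w : ℝ × Vec n => nrm w.2) (g := fun w => T w.1)
          (hnm.comp measurable_snd).aestronglyMeasurable
          (hT.comp measurable_fst).aestronglyMeasurable hp)
    refine ne_top_of_le_ne_top hsum (eLpNorm_mono_real fun w => ?_)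
    rw [Function.comp_apply, Real.norm_of_nonneg (hn.nonneg _)]
    have h3 := hn.2.2 w.2 (Y w - w.2)
    rw [add_sub_cancel] at h3
    linarith [hYd w]
  · have := wassersteinD_map_le hn hp M hYm measurable_snd
    rw [hM2] at this
    exact this.trans hdiff
  · have hHL := lintegral_mul_comp_le_quantile (M := M) (U := Prod.fst) measurable_fst hM1
      (hA.comp hYm) (fun _ => absDotp_nonneg β _) (monotoneOn_leftDeriv_Ioo hconv)
      (leftDeriv_nonneg hmono)
    rw [Measure.map_map hA hYm]
    refine le_trans (le_of_eq ?_) hHL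
    rw [lDistortion_eq_lintegral hconv hprob hM1 hMQ]
    have hTint : ∫⁻ s, ENNReal.ofReal (leftDeriv h s) * ENNReal.ofReal (T s) ∂unif01
        = ∫⁻ w, ENNReal.ofReal (leftDeriv h w.1) * ENNReal.ofReal (T w.1) ∂M := by
      conv_lhs => rw [← hM1]
      rw [lintegral_map' (hM1 ▸ hgm.ennreal_ofReal.mul hT.aemeasurable.ennreal_ofReal)
        measurable_fst.aemeasurable]
    have hm : AEMeasurable (fun w : ℝ × Vec n =>
        ENNReal.ofReal (leftDeriv h w.1) * ENNReal.ofReal (absDotp β w.2)) M :=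
      hgM.ennreal_ofReal.mul (hA.comp measurable_snd).aemeasurable.ennreal_ofReal
    rw [hTint, ← lintegral_const_mul' _ _ ENNReal.ofReal_ne_top, ← lintegral_add_left' hm]
    refine lintegral_congr fun w => ?_
    simp only [Function.comp, hYabs]
    rw [ENNReal.ofReal_add (absDotp_nonneg β _) (mul_nonneg hb (hT0 _)), ENNReal.ofReal_mul hb]
    ring

/-- The worst-case distortion over the Wasserstein ball. -/
lemma isLUB_distortion_ball (hn : IsNorm nrm) (hmono : MonotoneOn h (Set.Icc 0 1))
    (hconv : ConvexOn ℝ (Set.Icc 0 1) h) (hp : 1 ≤ p) (hpq : p⁻¹ + q⁻¹ = 1)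
    (hfin : eLpNorm (leftDeriv h) q unif01 ≠ ∞) {F₀ : Measure (Vec n)}
    [IsProbabilityMeasure F₀] (hmom : HasMomentP nrm p F₀) {ε : ℝ} (hε : 0 ≤ ε) (β : Vec n) :
    IsLUB {s | ∃ F ∈ WballVec nrm p F₀ ε, s = distortion h (F.map (absDotp β))}
      (distortion h (F₀.map (absDotp β))
        + (eLpNorm (leftDeriv h) q unif01).toReal * ε * dualNorm nrm β) := by
  rw [hasMomentP_iff hn hp] at hmom
  have hfin₀ := lDistortion_ne_top hn hconv hpq hfin hmom β
  set K := eLpNorm (leftDeriv h) q unif01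
  have hb := dualNorm_nonneg hn β
  have hCtop : ENNReal.ofReal (dualNorm nrm β) * (K * ENNReal.ofReal ε) ≠ ∞ :=
    ENNReal.mul_ne_top ENNReal.ofReal_ne_top (ENNReal.mul_ne_top hfin ENNReal.ofReal_ne_top)
  have hC : (ENNReal.ofReal (dualNorm nrm β) * (K * ENNReal.ofReal ε)).toReal
      = K.toReal * ε * dualNorm nrm β := by
    rw [ENNReal.toReal_mul, ENNReal.toReal_mul, ENNReal.toReal_ofReal hb, ENNReal.toReal_ofReal hε]
    ring
  rw [distortion_map_absDotp hmono hconv F₀]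
  constructor
  · rintro _ ⟨F, hF, rfl⟩
    have := hF.1
    rw [distortion_map_absDotp hmono hconv F, ← hC, ← ENNReal.toReal_add hfin₀ hCtop]
    exact ENNReal.toReal_mono (ENNReal.add_ne_top.2 ⟨hfin₀, hCtop⟩)
      (lDistortion_le_of_mem_ball hn hmono hconv hp hpq hfin hF β)
  · intro a ha
    have hgm : AEMeasurable (leftDeriv h) unif01 :=
      (monotoneOn_leftDeriv_Ioo hconv).aemeasurable_unif01
    have hbase : ∀ T : ℝ → ℝ, Measurable T → 0 ≤ T → eLpNorm T p unif01 ≤ 1 →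
        (lDistortion h (F₀.map (absDotp β))).toReal + dualNorm nrm β * (ε *
          (∫⁻ s, ENNReal.ofReal (leftDeriv h s) * ENNReal.ofReal (T s) ∂unif01).toReal) ≤ a := by
      intro T hT hT0 hT1
      have hscale : eLpNorm (fun s => ε * T s) p unif01 ≤ ENNReal.ofReal ε := by
        have := eLpNorm_const_smul ε T p unif01
        change eLpNorm (fun s => ε * T s) p unif01 = _ at this
        rw [this, Real.enorm_of_nonneg hε]
        exact mul_le_of_le_one_right' hT1
      obtain ⟨F, hF, hle⟩ := exists_mem_ball_lDistortion_ge hn hmono hconv hp hmom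
        (hT.const_mul ε) (fun s => mul_nonneg hε (hT0 s)) hscale β
      have := hF.1
      have hFtop := lDistortion_ne_top hn hconv hpq hfin ((hasMomentP_iff hn hp F).1 hF.2.1) β
      have hFa := ha ⟨F, hF, rfl⟩
      rw [distortion_map_absDotp hmono hconv F] at hFa
      refine le_trans (le_of_eq ?_) ((ENNReal.toReal_mono hFtop hle).trans hFa)
      rw [ENNReal.toReal_add hfin₀ (ne_top_of_le_ne_top hFtop (le_add_self.trans hle)),
        ENNReal.toReal_mul, ENNReal.toReal_ofReal hb]
      congr 2
      rw [← ENNReal.toReal_ofReal hε, ← ENNReal.toReal_mul, ENNReal.toReal_ofReal hε,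
        ← lintegral_const_mul' _ _ ENNReal.ofReal_ne_top]
      congr 1
      refine lintegral_congr fun s => ?_
      rw [ENNReal.ofReal_mul hε]
      ring
    have hlow : ∀ c : ℝ, 0 ≤ c → c < K.toReal →
        (lDistortion h (F₀.map (absDotp β))).toReal + dualNorm nrm β * (ε * c) ≤ a := by
      intro c hc0 hc
      have hcK : ENNReal.ofReal c < K := (ENNReal.ofReal_lt_iff_lt_toReal hc0 hfin).2 hc
      obtain ⟨T, hT, hT0, hT1, hcT⟩ := exists_lintegral_mul_gt hp hpq hgm
        (ae_unif01_mem.mono (leftDeriv_nonneg hmono)) hfin hcK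
      refine le_trans ?_ (hbase T hT hT0 hT1)
      have hTtop : ∫⁻ s, ENNReal.ofReal (leftDeriv h s) * ENNReal.ofReal (T s) ∂unif01 ≠ ∞ :=
        ne_top_of_le_ne_top (ENNReal.mul_ne_top hfin (ne_top_of_le_ne_top ENNReal.one_ne_top hT1))
          (lintegral_ofReal_mul_le_eLpNorm_mul hpq hT.aestronglyMeasurable hgm.aestronglyMeasurable)
      have := (ENNReal.ofReal_le_iff_le_toReal hTtop).1 hcT
      gcongr
    rcases (ENNReal.toReal_nonneg (a := K)).eq_or_lt with h0 | hpos
    · have := hbase 0 measurable_const le_rfl (by simp)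
      rw [← h0]
      simpa using this
    · have hlim : Filter.Tendsto (fun c : ℝ => (lDistortion h (F₀.map (absDotp β))).toReal
          + dualNorm nrm β * (ε * c)) (nhdsWithin K.toReal (Set.Iio K.toReal))
          (nhds ((lDistortion h (F₀.map (absDotp β))).toReal + dualNorm nrm β * (ε * K.toReal))) :=
        (Continuous.tendsto (by fun_prop) _).mono_left nhdsWithin_le_nhds
      have := le_of_tendsto hlim (by
        filter_upwards [Ioo_mem_nhdsLT hpos] with c hc using hlow c hc.1.le hc.2)
      linarith

lemma mem_WballVec_self (hn : IsNorm nrm) (hp : 1 ≤ p) {F₀ : Measure (Vec n)}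
    [IsProbabilityMeasure F₀] (hmom : HasMomentP nrm p F₀) (ε : ℝ) :
    F₀ ∈ WballVec nrm p F₀ ε := by
  refine ⟨inferInstance, hmom, ?_⟩
  have := wassersteinD_map_le hn hp F₀ measurable_id measurable_id
  rw [Measure.map_id] at this
  exact this.trans (by simp [hn.map_zero])

end Main

/-- Proposition 2(ii) of the paper: exact regularization for the
generalized `ν`-support vector regression problem, with the distortion functional
`ρ_h(|(1,-β_r)^⊤X|)` for an increasing convex distortion `h`. Here the ambient dimension is
`n + 1` and `D ⊆ ℝⁿ`. -/
theorem stmt18 {n : ℕ} (nrm : Vec (n + 1) → ℝ) (hnrm : IsNorm nrm)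
    (h : ℝ → ℝ) (hmono : MonotoneOn h (Set.Icc 0 1)) (hconv : ConvexOn ℝ (Set.Icc 0 1) h)
    (p q : ℝ≥0∞) (hp : 1 ≤ p) (hpq : p⁻¹ + q⁻¹ = 1)
    (hfin : LqNorm01 (fun s => leftDeriv h s) q ≠ ∞)
    (F₀ : Measure (Vec (n + 1))) (hF₀ : IsProbabilityMeasure F₀)
    (hmom : HasMomentP nrm p F₀)
    (ε : ℝ) (hε : 0 ≤ ε) (D : Set (Vec n)) :
    sInf {r | ∃ βr ∈ D, r =
        sSup {s | ∃ F ∈ WballVec nrm p F₀ ε,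
          s = distortion h (F.map (fun x => |dotp (Fin.cons 1 (-βr)) x|))}}
      = sInf {r | ∃ βr ∈ D, r =
          distortion h (F₀.map (fun x => |dotp (Fin.cons 1 (-βr)) x|))
            + (LqNorm01 (fun s => leftDeriv h s) q).toReal
              * ε * dualNorm nrm (Fin.cons 1 (-βr))} := by
  congr 1
  ext r
  refine exists_congr fun βr => and_congr_right fun _ => ?_
  have hlub := isLUB_distortion_ball hnrm hmono hconv hp hpq hfin hmom hε (Fin.cons 1 (-βr))
  have hsup := hlub.csSup_eq ⟨_, F₀, mem_WballVec_self hnrm hp hmom ε, rfl⟩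
  exact Eq.congr_right hsup
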